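/- Let f : A → B be a morphism of effect algebras and let [x₁<x₂<…<x_{2n}] be an even-length chain in A. Then (f(x₂)⊖f(x₁)) ⊕ (f(x₄)⊖f(x₃)) ⊕ … ⊕ (f(x_{2n})⊖f(x_{2n-1})) is defined and equals m_B({f(x₁)} Δ {f(x₂)} Δ … Δ {f(x_{2n})}); consequently m_B ∘ T(U(f)) = U(f) ∘ m_A, i.e. U(f) is a morphism of Eilenberg-Moore algebras for the Kalmbach monad. -/

import Mathlib

attribute [local instance] Classical.propDecidable

universe u v w

/- Kalmbach extension machinery, parameterized by an explicit order relation. -/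



/-- `C` is a finite chain with an even number of elements w.r.t. the order `r`. -/
def IsEvenChainR {α : Type u} (r : α → α → Prop) (C : Finset α) : Prop :=
  (∀ a ∈ C, ∀ b ∈ C, r a b ∨ r b a) ∧ Even C.card

/-- `(a, b)` is one of the consecutive pairs `(x_{2i-1}, x_{2i})` of the even chain
`C = [x₁ < x₂ < … < x_{2n}]`: both belong to `C`, `a` occupies an odd position
(the number of elements of `C` below `a` is odd) and `b` is the immediate successor
of `a` in `C`. -/
def KalPairR {α : Type u} (r : α → α → Prop) (C : Finset α) (a b : α) : Prop :=
  a ∈ C ∧ b ∈ C ∧ r a b ∧ a ≠ b ∧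
    Odd (C.filter fun y => r y a).card ∧
    (∀ c ∈ C, r a c → c ≠ a → r b c)

/-- The Kalmbach order: `[x₁<x₂<…<x_{2n}] ≤ [y₁<y₂<…<y_{2k}]` iff for every `i`
there is `j` with `y_{2j-1} ≤ x_{2i-1} < x_{2i} ≤ y_{2j}`. -/
def KalLER {α : Type u} (r : α → α → Prop) (C D : Finset α) : Prop :=
  ∀ a b, KalPairR r C a b → ∃ c d, KalPairR r D c d ∧ r c a ∧ r b d

/-- The carrier of the Kalmbach extension `K(P)`: all finite chains with an even
number of elements (with elements taken from the carrier `S`). -/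
def KalCarrier {α : Type u} (S : Set α) (r : α → α → Prop) : Set (Finset α) :=
  {C | ↑C ⊆ S ∧ IsEvenChainR r C}

/-- Orthocomplementation on the Kalmbach extension: `C ↦ C Δ {0, 1}`. -/
noncomputable def kalComplF {α : Type u} (z u : α) (C : Finset α) : Finset α :=
  symmDiff C {z, u}

/-- The unit `η` of the Kalmbach adjunction: `η(0) = ∅` and `η(a) = [0 < a]` for `a > 0`. -/
noncomputable def kalEtaF {α : Type u} (z : α) (a : α) : Finset α :=
  if a = z then ∅ else {z, a}

/-- Symmetric difference of a finite family of finite sets: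
`Δᵢ Cᵢ = {x | x belongs to an odd number of the Cᵢ}`. -/
noncomputable def kalMuF {α : Type u} (𝒞 : Finset (Finset α)) : Finset α :=
  (𝒞.sup id).filter fun x => Odd (𝒞.filter fun C => x ∈ C).card

/-- `K(f)(C) = Δ_{x ∈ C} {f x}`, i.e. the set of `y` such that the number of
elements of `C` mapped to `y` is odd. -/
noncomputable def kalMapF {α : Type u} {β : Type v} (f : α → β) (C : Finset α) : Finset β :=
  (C.image f).filter fun y => Odd (C.filter fun x => f x = y).card

/-- Enumerate a finite chain in increasing order (w.r.t. `r`) as a list. -/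
noncomputable def chainSortR {α : Type u} (r : α → α → Prop) (C : Finset α) : List α :=
  C.toList.mergeSort fun a b => decide (r a b)


/-- An effect algebra: a partial algebra `(E, ⊕, 0, 1)`, encoded by the domain
predicate `D` of the partial operation `⊕` together with a total function `add`
(whose values outside `D` are irrelevant), satisfying axioms (E1)-(E4). -/
structure EffectAlgebra (E : Type u) : Type u where
  /-- `D a b` means that `a ⊕ b` is defined. -/
  D : E → E → Prop
  /-- the partial sum `a ⊕ b` -/
  add : E → E → E
  zero : E
  one : E
  /-- (E1) -/
  D_comm : ∀ {a b}, D a b → D b a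
  /-- (E1) -/
  add_comm : ∀ {a b}, D a b → add a b = add b a
  /-- (E2) -/
  D_of_assoc : ∀ {a b c}, D a b → D (add a b) c → D b c
  /-- (E2) -/
  D_assoc : ∀ {a b c}, D a b → D (add a b) c → D a (add b c)
  /-- (E2) -/
  add_assoc : ∀ {a b c}, D a b → D (add a b) c → add (add a b) c = add a (add b c)
  /-- (E3) -/
  orthosupplement : ∀ a, ∃! x, D a x ∧ add a x = one
  /-- (E4) -/
  D_one : ∀ {a}, D a one → a = zero

namespace EffectAlgebra

/-- The induced order of an effect algebra: `a ≤ b` iff `∃ c, a ⊕ c = b`. -/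
def le {E : Type u} (A : EffectAlgebra E) (a b : E) : Prop :=
  ∃ c, A.D a c ∧ A.add a c = b

/-- The orthosupplement `a'`: the unique element with `a ⊕ a' = 1`. -/
noncomputable def orth {E : Type u} (A : EffectAlgebra E) (a : E) : E :=
  (A.orthosupplement a).exists.choose

/-- The partial difference: for `a ≤ b`, `sub b a` is the unique `c` with `a ⊕ c = b`
(and a junk value `0` otherwise). -/
noncomputable def sub {E : Type u} (A : EffectAlgebra E) (b a : E) : E :=
  if h : ∃ c, A.D a c ∧ A.add a c = b then h.choose else A.zero

/-- A morphism of effect algebras: `f 1 = 1`, and whenever `a ⊕ b` is defined,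
`f a ⊕ f b` is defined and equals `f (a ⊕ b)`. -/
def Hom {E : Type u} {F : Type v} (A : EffectAlgebra E) (B : EffectAlgebra F)
    (f : E → F) : Prop :=
  f A.one = B.one ∧ ∀ a b, A.D a b → B.D (f a) (f b) ∧ f (A.add a b) = B.add (f a) (f b)

end EffectAlgebra

/-- `eaSumList A [x₁, x₂, …, x_{2n}] = (x₂ ⊖ x₁) ⊕ (x₄ ⊖ x₃) ⊕ … ⊕ (x_{2n} ⊖ x_{2n-1})`. -/
noncomputable def eaSumList {E : Type u} (A : EffectAlgebra E) : List E → E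
  | [] => A.zero
  | [_] => A.zero
  | a :: b :: l => A.add (A.sub b a) (eaSumList A l)

/-- All differences and sums occurring in `eaSumList` are defined. -/
def eaSumListDefined {E : Type u} (A : EffectAlgebra E) : List E → Prop
  | [] => True
  | [_] => False
  | a :: b :: l => A.le a b ∧ A.D (A.sub b a) (eaSumList A l) ∧ eaSumListDefined A l

/-- The structure map `m_A : K(U(A)) → U(A)`,
`m_A [x₁<x₂<…<x_{2n}] = (x₂ ⊖ x₁) ⊕ … ⊕ (x_{2n} ⊖ x_{2n-1})`. -/
noncomputable def eaM {E : Type u} (A : EffectAlgebra E) (C : Finset E) : E :=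
  eaSumList A (chainSortR A.le C)

namespace EffectAlgebra

theorem D_zero' {E : Type u} (A : EffectAlgebra E) (a : E) : A.D a A.zero ∧ A.add a A.zero = a := by
  have h1 : A.D A.one A.zero ∧ A.add A.one A.zero = A.one := by
    obtain ⟨x, ⟨hx, hx'⟩, -⟩ := A.orthosupplement A.one
    have := A.D_one (A.D_comm hx)
    subst this
    exact ⟨hx, hx'⟩
  obtain ⟨x, ⟨hx, hx'⟩, -⟩ := A.orthosupplement a
  have hd : A.D (A.add x a) A.zero := by
    rw [A.add_comm (A.D_comm hx), hx']; exact h1.1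
  have h2 := A.D_of_assoc (A.D_comm hx) hd
  have h3 := A.D_assoc (A.D_comm hx) hd
  have h4 := A.add_assoc (A.D_comm hx) hd
  refine ⟨h2, ?_⟩
  have h5 : A.add x a = A.one := by rw [A.add_comm (A.D_comm hx), hx']
  rw [h5, h1.2] at h4
  exact (A.orthosupplement x).unique ⟨h3, h4.symm⟩ ⟨A.D_comm hx, h5⟩

theorem cancel {E : Type u} (A : EffectAlgebra E) {a b c : E} (hb : A.D a b) (hc : A.D a c)
    (h : A.add a b = A.add a c) : b = c := by
  obtain ⟨d, ⟨hd, hd'⟩, -⟩ := A.orthosupplement (A.add a b)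
  have key : ∀ x, A.D a x → A.D (A.add a x) d → A.add (A.add a x) d = A.one →
      A.D (A.add a d) x ∧ A.add (A.add a d) x = A.one := by
    intro x hx hxd he
    rw [A.add_comm hx] at hxd he
    have h1 := A.D_assoc (A.D_comm hx) hxd
    have h2 := A.add_assoc (A.D_comm hx) hxd
    refine ⟨A.D_comm h1, ?_⟩
    rw [A.add_comm (A.D_comm h1), ← h2, he]
  exact (A.orthosupplement (A.add a d)).unique (key b hb hd hd') (key c hc (h ▸ hd) (h ▸ hd'))

theorem le_refl' {E : Type u} (A : EffectAlgebra E) (a : E) : A.le a a :=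
  ⟨A.zero, A.D_zero' a⟩

theorem le_trans' {E : Type u} (A : EffectAlgebra E) {a b c : E} (h : A.le a b) (h' : A.le b c) :
    A.le a c := by
  obtain ⟨x, hx, rfl⟩ := h
  obtain ⟨y, hy, rfl⟩ := h'
  exact ⟨_, A.D_assoc hx hy, (A.add_assoc hx hy).symm⟩

theorem le_antisymm' {E : Type u} (A : EffectAlgebra E) {a b : E} (h : A.le a b) (h' : A.le b a) :
    a = b := by
  obtain ⟨x, hx, rfl⟩ := h
  obtain ⟨y, hy, hy'⟩ := h'
  have h1 : A.add x y = A.zero := by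
    apply A.cancel (A.D_assoc hx hy) (A.D_zero' a).1
    rw [← A.add_assoc hx hy, hy', (A.D_zero' a).2]
  have h2 : A.D (A.add x y) A.one := by
    rw [h1]; exact A.D_comm (A.D_zero' _).1
  have h3 := A.D_one (A.D_of_assoc (A.D_of_assoc hx hy) h2)
  subst h3
  exact hy'.symm.trans (A.D_zero' _).2

theorem sub_spec {E : Type u} (A : EffectAlgebra E) {a b : E} (h : A.le a b) :
    A.D a (A.sub b a) ∧ A.add a (A.sub b a) = b := by
  unfold sub
  have h' : ∃ c, A.D a c ∧ A.add a c = b := h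
  rw [dif_pos h']
  exact h'.choose_spec

theorem sub_eq {E : Type u} (A : EffectAlgebra E) {a b c : E} (h : A.D a c) (h' : A.add a c = b) :
    A.sub b a = c := by
  have h2 := A.sub_spec ⟨c, h, h'⟩
  exact A.cancel h2.1 h (h2.2.trans h'.symm)

theorem D_mono {E : Type u} (A : EffectAlgebra E) {a b c : E} (h : A.le a b) (h' : A.D b c) :
    A.D a c := by
  obtain ⟨x, hx, rfl⟩ := h
  rw [A.add_comm hx] at h'
  exact A.D_of_assoc (A.D_comm hx) h'

theorem sub_self' {E : Type u} (A : EffectAlgebra E) (a : E) : A.sub a a = A.zero :=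
  A.sub_eq (A.D_zero' a).1 (A.D_zero' a).2

theorem zero_add' {E : Type u} (A : EffectAlgebra E) (a : E) : A.add A.zero a = a := by
  rw [A.add_comm (A.D_comm (A.D_zero' a).1), (A.D_zero' a).2]

theorem Hom.map_zero {E : Type u} {F : Type v} {A : EffectAlgebra E} {B : EffectAlgebra F}
    {f : E → F} (hf : A.Hom B f) : f A.zero = B.zero := by
  have h := hf.2 _ _ (A.D_zero' A.zero).1
  rw [(A.D_zero' A.zero).2] at h
  exact B.cancel h.1 (B.D_zero' _).1 (h.2.symm.trans (B.D_zero' _).2.symm)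

theorem Hom.mono {E : Type u} {F : Type v} {A : EffectAlgebra E} {B : EffectAlgebra F}
    {f : E → F} (hf : A.Hom B f) {a b : E} (h : A.le a b) : B.le (f a) (f b) := by
  obtain ⟨x, hx, rfl⟩ := h
  exact ⟨f x, (hf.2 _ _ hx).1, (hf.2 _ _ hx).2.symm⟩

theorem Hom.map_sub {E : Type u} {F : Type v} {A : EffectAlgebra E} {B : EffectAlgebra F}
    {f : E → F} (hf : A.Hom B f) {a b : E} (h : A.le a b) :
    f (A.sub b a) = B.sub (f b) (f a) := by
  have h1 := A.sub_spec h
  have h2 := hf.2 _ _ h1.1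
  rw [h1.2] at h2
  exact (B.sub_eq h2.1 h2.2.symm).symm

end EffectAlgebra

theorem eaSum_def {E : Type u} (A : EffectAlgebra E) : ∀ (l : List E), l.Pairwise A.le →
    Even l.length → eaSumListDefined A l ∧ ∀ c, (∀ x ∈ l, A.le c x) → A.D c (eaSumList A l)
  | [], _, _ => ⟨trivial, fun c _ => (A.D_zero' c).1⟩
  | [_], _, h => by simp at h
  | a :: b :: l, hp, he => by
    have hp1 := List.pairwise_cons.1 hp
    have hp2 := List.pairwise_cons.1 hp1.2
    have hab : A.le a b := hp1.1 b (by simp)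
    have he' : Even l.length := by
      simp only [List.length_cons] at he
      grind
    obtain ⟨ih1, ih2⟩ := eaSum_def A l hp2.2 he'
    have hb := ih2 b hp2.1
    have hs := A.sub_spec hab
    have hb' := hb
    rw [← hs.2] at hb'
    refine ⟨⟨hab, A.D_of_assoc hs.1 hb', ih1⟩, ?_⟩
    intro c hc
    exact A.D_mono (hc a (by simp)) (A.D_assoc hs.1 hb')

theorem eaSum_map {E : Type u} {F : Type v} {A : EffectAlgebra E} {B : EffectAlgebra F}
    {f : E → F} (hf : A.Hom B f) : ∀ (l : List E), eaSumListDefined A l →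
    f (eaSumList A l) = eaSumList B (l.map f)
  | [], _ => hf.map_zero
  | [_], h => h.elim
  | a :: b :: l, ⟨h1, h2, h3⟩ => by
    simp only [eaSumList, List.map]
    rw [(hf.2 _ _ h2).2, hf.map_sub h1, eaSum_map hf l h3]

theorem eaSum_remove {E : Type u} (A : EffectAlgebra E) (a : E) (q : List E) : ∀ (p : List E),
    (p ++ a :: a :: q).Pairwise A.le → Even (p ++ a :: a :: q).length →
    eaSumList A (p ++ a :: a :: q) = eaSumList A (p ++ q)
  | [], _, _ => by
    simp only [List.nil_append, eaSumList]
    rw [A.sub_self', A.zero_add']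
  | [x], hp, he => by
    cases q with
    | nil => simp at he; grind
    | cons y q =>
      obtain ⟨⟨h1, h2, h3, h4, h5⟩, -⟩ := eaSum_def A _ hp he
      have hp' := hp
      simp only [List.cons_append, List.nil_append] at hp' h1 h2 h3 h4 h5 ⊢
      simp only [eaSumList] at h2 h4 ⊢
      have hs1 := A.sub_spec h1
      have hs2 := A.sub_spec h3
      -- (a-x) + ((y-a) + S) = ((a-x)+(y-a)) + S
      have h6 : A.D (A.add x (A.sub a x)) (A.sub y a) := by rw [hs1.2]; exact hs2.1
      have h7 : A.sub y x = A.add (A.sub a x) (A.sub y a) := by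
        apply A.sub_eq (A.D_assoc hs1.1 h6)
        rw [← A.add_assoc hs1.1 h6, hs1.2, hs2.2]
      rw [h7]
      -- symmetric associativity
      have c1 := A.D_comm h2
      rw [A.add_comm h4] at c1 h2 ⊢
      have c2 := A.D_comm h4
      have c3 := A.D_of_assoc c2 c1
      have c4 := A.D_assoc c2 c1
      have c5 := A.add_assoc c2 c1
      rw [A.add_comm h2, c5, A.add_comm c4, A.add_comm c3]
  | x :: y :: p, hp, he => by
    simp only [List.cons_append, eaSumList]
    simp only [List.cons_append] at hp he
    rw [eaSum_remove A a q p hp.of_cons.of_cons (by simp only [List.length_cons] at he; grind)]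

theorem chainSort_spec {E : Type u} (A : EffectAlgebra E) (C : Finset E)
    (h : ∀ a ∈ C, ∀ b ∈ C, A.le a b ∨ A.le b a) :
    (chainSortR A.le C).Perm C.toList ∧ (chainSortR A.le C).Pairwise A.le := by
  refine ⟨List.mergeSort_perm _ _, ?_⟩
  have hm := List.map_mergeSort (r := fun a b : {x // x ∈ C.toList} => decide (A.le a.1 b.1))
    (s := fun a b => decide (A.le a b)) (f := Subtype.val) (l := C.toList.attach) (by simp)
  rw [List.attach_map_subtype_val] at hm
  unfold chainSortR
  rw [← hm, List.pairwise_map]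
  refine (List.pairwise_mergeSort ?_ ?_ _).imp ?_
  · intro a b c h1 h2
    simp only [decide_eq_true_eq] at h1 h2 ⊢
    exact A.le_trans' h1 h2
  · rintro ⟨a, ha⟩ ⟨b, hb⟩
    simpa using h a (by simpa using ha) b (by simpa using hb)
  · intro a b h1
    simpa using h1

theorem exists_dup {E : Type u} (A : EffectAlgebra E) : ∀ (l : List E), l.Pairwise A.le →
    ¬ l.Nodup → ∃ p a q, l = p ++ a :: a :: q
  | [], _, h => by simp at h
  | [_], _, h => by simp at h
  | a :: b :: l, hp, hn => by
    by_cases hab : a = b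
    · subst hab
      exact ⟨[], a, l, rfl⟩
    · by_cases hn' : (b :: l).Nodup
      · exfalso
        apply hn
        refine List.nodup_cons.2 ⟨?_, hn'⟩
        intro hmem
        rcases List.mem_cons.1 hmem with h | h
        · exact hab h
        · have hp1 := List.pairwise_cons.1 hp
          have hp2 := List.pairwise_cons.1 hp1.2
          exact hab (A.le_antisymm' (hp1.1 b (by simp)) (hp2.1 a h))
      · obtain ⟨p, c, q, h⟩ := exists_dup A (b :: l) hp.of_cons hn'
        exact ⟨a :: p, c, q, by rw [h]; rfl⟩

noncomputable def oddL {E : Type u} (l : List E) : Finset E :=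
  l.toFinset.filter fun y => Odd (l.count y)

theorem mem_oddL {E : Type u} (l : List E) (y : E) : y ∈ oddL l ↔ Odd (l.count y) := by
  unfold oddL
  rw [Finset.mem_filter, List.mem_toFinset]
  refine ⟨fun h => h.2, fun h => ⟨?_, h⟩⟩
  exact List.count_pos_iff.1 h.pos

theorem oddL_remove {E : Type u} (a : E) (p q : List E) :
    oddL (p ++ a :: a :: q) = oddL (p ++ q) := by
  ext y
  rw [mem_oddL, mem_oddL]
  simp only [List.count_append, List.count_cons]
  split_ifs <;> grind

theorem eaSum_odd {E : Type u} (A : EffectAlgebra E) (n : ℕ) : ∀ (l : List E), l.length ≤ n →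
    l.Pairwise A.le → Even l.length → eaSumList A l = eaM A (oddL l) := by
  induction n with
  | zero =>
    intro l hl _ _
    have : l = [] := by simpa using hl
    subst this
    have : oddL ([] : List E) = ∅ := by simp [oddL]
    simp [this, eaM, chainSortR]
  | succ n ih =>
    intro l hl hp he
    by_cases hn : l.Nodup
    · have h1 : oddL l = l.toFinset := by
        ext y
        rw [mem_oddL, List.mem_toFinset]
        constructor
        · intro h; exact List.count_pos_iff.1 h.pos
        · intro h; rw [List.count_eq_one_of_mem hn h]; exact odd_one
      have htot : ∀ a ∈ l.toFinset, ∀ b ∈ l.toFinset, A.le a b ∨ A.le b a := by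
        intro a ha b hb
        rw [List.mem_toFinset] at ha hb
        have : Std.Symm (fun a b => A.le a b ∨ A.le b a) := ⟨fun _ _ h => Or.symm h⟩
        exact List.Pairwise.forall_of_forall (R := fun a b => A.le a b ∨ A.le b a)
          (fun a _ => Or.inl (A.le_refl' a)) (hp.imp Or.inl) ha hb
      obtain ⟨hs1, hs2⟩ := chainSort_spec A l.toFinset htot
      rw [h1]
      unfold eaM
      congr 1
      have hperm : l.Perm (chainSortR A.le l.toFinset) :=
        ((List.toFinset_toList hn).trans (List.Perm.refl _)).symm.trans hs1.symm
      exact hperm.eq_of_pairwise (fun a b _ _ h h' => A.le_antisymm' h h') hp hs2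
    · obtain ⟨p, a, q, rfl⟩ := exists_dup A l hp hn
      rw [eaSum_remove A a q p hp he, oddL_remove]
      apply ih
      · simp only [List.length_append, List.length_cons] at hl ⊢; omega
      · refine hp.sublist ?_
        exact List.Sublist.append_left (by simp) p
      · simp only [List.length_append, List.length_cons] at he ⊢; grind

theorem kalMap_eq {E : Type u} {F : Type v} (f : E → F) (C : Finset E) (l : List E)
    (h : l.Perm C.toList) : kalMapF f C = oddL (l.map f) := by
  ext y
  have hc : (C.filter fun x => f x = y).card = (l.map f).count y := by
    have hfun : ((fun x => x == y) ∘ f) = fun x => decide (f x = y) := by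
      funext x
      rw [Bool.eq_iff_iff]
      simp
    rw [(h.map f).count_eq, List.count, List.countP_map, hfun, ← Multiset.coe_countP, Finset.coe_toList,
      Multiset.countP_eq_card_filter, Finset.card_def, Finset.filter_val]
  rw [mem_oddL, ← hc]
  unfold kalMapF
  rw [Finset.mem_filter]
  refine ⟨fun h => h.2, fun h => ⟨?_, h⟩⟩
  obtain ⟨x, hx⟩ := Finset.card_pos.1 h.pos
  rw [Finset.mem_filter] at hx
  exact Finset.mem_image.2 ⟨x, hx⟩

/-- Let `f : A → B` be a morphism of effect algebras and
`[x₁<x₂<…<x_{2n}]` an even chain in `A`.  Then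
`(f x₂ ⊖ f x₁) ⊕ … ⊕ (f x_{2n} ⊖ f x_{2n-1})` is defined and equals
`m_B ({f x₁} Δ … Δ {f x_{2n}})`; consequently `m_B ∘ T(U f) = U f ∘ m_A`, i.e.
`U f` is a morphism of Eilenberg-Moore algebras for the Kalmbach monad. -/
theorem effect_algebra_hom_is_EM_hom {E : Type u} {F : Type v}
    (A : EffectAlgebra E) (B : EffectAlgebra F) (f : E → F) (hf : A.Hom B f)
    (C : Finset E) (hC : C ∈ KalCarrier Set.univ A.le) :
    eaSumListDefined B ((chainSortR A.le C).map f) ∧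
    eaSumList B ((chainSortR A.le C).map f) = eaM B (kalMapF f C) ∧
    f (eaM A C) = eaM B (kalMapF f C) := by
  obtain ⟨-, htot, hev⟩ := hC
  obtain ⟨hs1, hs2⟩ := chainSort_spec A C htot
  have hlen : Even (chainSortR A.le C).length := by
    rw [hs1.length_eq, Finset.length_toList]; exact hev
  have hp : ((chainSortR A.le C).map f).Pairwise B.le :=
    List.pairwise_map.2 (hs2.imp fun h => hf.mono h)
  have hlen' : Even ((chainSortR A.le C).map f).length := by rwa [List.length_map]
  have h2 : eaSumList B ((chainSortR A.le C).map f) = eaM B (kalMapF f C) := by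
    rw [kalMap_eq f C _ hs1]
    exact eaSum_odd B _ _ le_rfl hp hlen'
  refine ⟨(eaSum_def B _ hp hlen').1, h2, ?_⟩
  rw [← h2]
  exact eaSum_map hf _ (eaSum_def A _ hs2 hlen).1
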